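/- arXiv:2110.12650 — 10 statements merged into one kernel-verified Lean document; each statement's English description precedes it below -/
import Mathlib

section
/- Let V ⊆ ℝ^d be a compact set, P = conv(V) a compact convex set of diameter D > 0, and let f : ℝ^d → ℝ be differentiable, convex and L-smooth, with x* a minimizer of f over P. For every BPCG run on (f, V) and every integer T ≥ 1, the iterate x_T satisfies f(x_T) − f(x*) ≤ 4LD²/T. (Theorem 3.1) -/
open scoped RealInnerProductSpace BigOperators

attribute [local instance] Classical.propDecidable

noncomputable section

variable {H : Type*} [NormedAddCommGroup H] [InnerProductSpace ℝ H]

/-- A run of the Blended Pairwise Conditional Gradients (BPCG) algorithm on `(f, V)`,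
where `g` is the gradient of `f`.  It records the iterates `x t`, the active sets `S t`,
the weights `c t`, the away vertex `a t`, the local Frank-Wolfe vertex `s t`, the global
Frank-Wolfe vertex `w t` and the step sizes `lam t`. -/
structure BPCGRun (f : H → ℝ) (g : H → H) (V : Set H) where
  x : ℕ → H
  S : ℕ → Finset H
  c : ℕ → H → ℝ
  a : ℕ → H
  s : ℕ → H
  w : ℕ → H
  lam : ℕ → ℝ
  init_x : x 0 ∈ V
  init_S : S 0 = {x 0}
  init_c : c 0 (x 0) = 1
  S_subset : ∀ t, (S t : Set H) ⊆ V
  c_pos : ∀ t, ∀ v ∈ S t, 0 < c t v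
  c_le_one : ∀ t, ∀ v ∈ S t, c t v ≤ 1
  c_sum : ∀ t, ∑ v ∈ S t, c t v = 1
  x_eq : ∀ t, x t = ∑ v ∈ S t, c t v • v
  a_mem : ∀ t, a t ∈ S t
  a_max : ∀ t, ∀ v ∈ S t, ⟪g (x t), v⟫ ≤ ⟪g (x t), a t⟫
  s_mem : ∀ t, s t ∈ S t
  s_min : ∀ t, ∀ v ∈ S t, ⟪g (x t), s t⟫ ≤ ⟪g (x t), v⟫
  w_mem : ∀ t, w t ∈ V
  w_min : ∀ t, ∀ v ∈ V, ⟪g (x t), w t⟫ ≤ ⟪g (x t), v⟫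
  /-- Pairwise step: taken when `⟪∇f(x_t), a_t - s_t⟫ ≥ ⟪∇f(x_t), x_t - w_t⟫`. -/
  step_pairwise : ∀ t, ⟪g (x t), x t - w t⟫ ≤ ⟪g (x t), a t - s t⟫ →
    lam t ∈ Set.Icc (0 : ℝ) (c t (a t)) ∧
    (∀ μ ∈ Set.Icc (0 : ℝ) (c t (a t)),
      f (x t - lam t • (a t - s t)) ≤ f (x t - μ • (a t - s t))) ∧
    x (t + 1) = x t - lam t • (a t - s t) ∧
    (lam t < c t (a t) → S (t + 1) = S t) ∧
    (lam t = c t (a t) → S (t + 1) = (S t).erase (a t)) ∧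
    (∀ v, c (t + 1) v =
      c t v + (if v = s t then lam t else 0) - (if v = a t then lam t else 0))
  /-- Frank-Wolfe step: taken when `⟪∇f(x_t), a_t - s_t⟫ < ⟪∇f(x_t), x_t - w_t⟫`. -/
  step_fw : ∀ t, ⟪g (x t), a t - s t⟫ < ⟪g (x t), x t - w t⟫ →
    lam t ∈ Set.Icc (0 : ℝ) 1 ∧
    (∀ μ ∈ Set.Icc (0 : ℝ) 1,
      f (x t - lam t • (x t - w t)) ≤ f (x t - μ • (x t - w t))) ∧
    x (t + 1) = x t - lam t • (x t - w t) ∧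
    S (t + 1) = insert (w t) (S t) ∧
    (∀ v, c (t + 1) v = (1 - lam t) * c t v + (if v = w t then lam t else 0))

/-- First-order characterization of convexity. -/
theorem bpcg_first_order (f : H → ℝ) (g : H → H)
    (hdiff : ∀ y, HasFDerivAt f (innerSL ℝ (g y)) y)
    (hconv : ConvexOn ℝ Set.univ f) (x y : H) : f x + ⟪g x, y - x⟫ ≤ f y := by
  have hc : ConvexOn ℝ Set.univ (fun t : ℝ => f (AffineMap.lineMap x y t)) := by
    have := hconv.comp_affineMap (AffineMap.lineMap x y : ℝ →ᵃ[ℝ] H)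
    simpa [Function.comp_def] using this
  have hd : HasDerivAt (fun t : ℝ => f (AffineMap.lineMap x y t)) ⟪g x, y - x⟫ 0 := by
    have h1 : HasDerivAt (fun t : ℝ => (AffineMap.lineMap x y t : H)) (y - x) 0 :=
      AffineMap.hasDerivAt_lineMap
    have h2 : HasFDerivAt f (innerSL ℝ (g x)) (AffineMap.lineMap x y (0 : ℝ)) := by
      simpa using hdiff x
    have := h2.comp_hasDerivAt (0 : ℝ) h1
    simpa [Function.comp_def] using this
  have := hc.le_slope_of_hasDerivAt (Set.mem_univ 0) (Set.mem_univ 1) one_pos hd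
  simp [slope_def_field] at this
  linarith

/-- Progress of a step whose line search does not hit the upper end of its interval. -/
theorem bpcg_progress (f : H → ℝ) (g : H → H) (L D : ℝ) (hL : 0 ≤ L)
    (hconv : ConvexOn ℝ Set.univ f)
    (hsmooth : ∀ x y, f y - f x - ⟪g x, y - x⟫ ≤ L / 2 * ‖y - x‖ ^ 2)
    (x d : H) (lam Lam m : ℝ) (hd : ‖d‖ ≤ D) (h0 : 0 ≤ lam) (h1 : lam < Lam)
    (hls : ∀ μ ∈ Set.Icc (0 : ℝ) Lam, f (x - lam • d) ≤ f (x - μ • d))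
    (hm : m ≤ f x) (hG : f x - m ≤ ⟪g x, d⟫) :
    (f x - m) ^ 2 ≤ 2 * L * D ^ 2 * ((f x - m) - (f (x - lam • d) - m)) := by
  have hglob : ∀ μ : ℝ, 0 ≤ μ → f (x - lam • d) ≤ f (x - μ • d) := by
    intro μ hμ
    rcases le_or_gt μ Lam with h | h
    · exact hls μ ⟨hμ, h⟩
    · have hpos : 0 < μ - lam := by linarith
      have hc := hconv.2 (Set.mem_univ (x - lam • d)) (Set.mem_univ (x - μ • d))
        (div_nonneg (by linarith) hpos.le : 0 ≤ (μ - Lam) / (μ - lam))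
        (div_nonneg (by linarith) hpos.le : 0 ≤ (Lam - lam) / (μ - lam))
        (by field_simp; ring)
      have e : ((μ - Lam) / (μ - lam)) • (x - lam • d) + ((Lam - lam) / (μ - lam)) • (x - μ • d)
          = x - Lam • d := by
        match_scalars <;> field_simp <;> ring
      rw [e] at hc
      have h2 := hls Lam ⟨by linarith, le_rfl⟩
      simp only [smul_eq_mul] at hc
      have h3 : (μ - Lam) / (μ - lam) = 1 - (Lam - lam) / (μ - lam) := by field_simp; ring
      have hb : 0 < (Lam - lam) / (μ - lam) := div_pos (by linarith) hpos
      rw [h3] at hc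
      nlinarith
  set δ := f x - f (x - lam • d) with hδ
  have hδ0 : 0 ≤ δ := by
    have := hglob 0 le_rfl
    simp only [zero_smul, sub_zero] at this
    linarith
  have hdd : ‖d‖ ^ 2 ≤ D ^ 2 := by gcongr
  have hq : ∀ μ : ℝ, 0 ≤ (L * D ^ 2 / 2) * (μ * μ) + (-(⟪g x, d⟫)) * μ + δ := by
    intro μ
    have hC : 0 ≤ L * D ^ 2 / 2 := by positivity
    rcases le_or_gt 0 μ with h | h
    · have a1 := hsmooth x (x - μ • d)
      have a2 := hglob μ h
      have e1 : x - μ • d - x = -(μ • d) := by abel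
      rw [e1, inner_neg_right, real_inner_smul_right, norm_neg, norm_smul, mul_pow,
        Real.norm_eq_abs, sq_abs] at a1
      have a3 : L / 2 * (μ ^ 2 * ‖d‖ ^ 2) ≤ L / 2 * (μ ^ 2 * D ^ 2) := by gcongr
      nlinarith
    · have : 0 ≤ ⟪g x, d⟫ := by linarith
      nlinarith [mul_nonneg hC (mul_self_nonneg μ), mul_nonneg this (neg_nonneg.2 h.le)]
  have hdis := discrim_le_zero hq
  unfold discrim at hdis
  have : (f x - m) ^ 2 ≤ ⟪g x, d⟫ ^ 2 := by
    have : 0 ≤ f x - m := by linarith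
    gcongr
  have e : (f x - m) - (f (x - lam • d) - m) = δ := by rw [hδ]; ring
  rw [e]
  nlinarith

/-- The scalar recursion. -/
theorem bpcg_recursion (C h h' k : ℝ) (hC : 0 ≤ C) (hh' : 0 ≤ h') (hh : 0 ≤ h)
    (hle : h' ≤ h) (hk : 0 ≤ k) (hkh : k * h ≤ C) (hp : h ^ 2 ≤ C * (h - h')) : (k + 1) * h' ≤ C := by
  rcases hC.eq_or_lt with rfl | hC
  · have h0 : h = 0 := by nlinarith
    have h1 : h' = 0 := by linarith
    simp [h1]
  · have hhC : h ≤ C := by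
      by_contra hcon
      push Not at hcon
      nlinarith [mul_nonneg hC.le hh']
    have : 0 ≤ C * (C - (k + 1) * h') := by
      nlinarith [mul_nonneg (sub_nonneg.2 hhC) (sub_nonneg.2 hkh), sq_nonneg h,
        mul_le_mul_of_nonneg_left hp (by linarith : 0 ≤ k + 1)]
    have := nonneg_of_mul_nonneg_right this hC
    linarith

/-- **Theorem 3.1.** For a compact set `V ⊆ ℝ^d` whose convex hull `P` has diameter `D > 0`,
and a differentiable, convex, `L`-smooth `f` with minimizer `x*` over `P`, every BPCG run
on `(f, V)` satisfies `f(x_T) - f(x*) ≤ 4LD²/T` for all `T ≥ 1`. -/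
theorem bpcg_convergence_smooth_convex
    {d : ℕ} (V : Set (EuclideanSpace ℝ (Fin d))) (hVcpt : IsCompact V)
    (D L : ℝ) (hD : Metric.diam (convexHull ℝ V) = D) (hDpos : 0 < D)
    (f : EuclideanSpace ℝ (Fin d) → ℝ)
    (g : EuclideanSpace ℝ (Fin d) → EuclideanSpace ℝ (Fin d))
    (hdiff : ∀ y, HasFDerivAt f (innerSL ℝ (g y)) y)
    (hconv : ConvexOn ℝ Set.univ f)
    (hsmooth : ∀ x y, f y - f x - ⟪g x, y - x⟫ ≤ L / 2 * ‖y - x‖ ^ 2)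
    (xstar : EuclideanSpace ℝ (Fin d)) (hxstar : xstar ∈ convexHull ℝ V)
    (hmin : ∀ y ∈ convexHull ℝ V, f xstar ≤ f y)
    (run : BPCGRun f g V) (T : ℕ) (hT : 1 ≤ T) :
    f (run.x T) - f xstar ≤ 4 * L * D ^ 2 / (T : ℝ) := by
  set C := 2 * L * D ^ 2 with hCdef
  have hfo := bpcg_first_order f g hdiff hconv
  have hL : 0 ≤ L := by
    by_contra hneg
    push Not at hneg
    have hsub : (convexHull ℝ V).Subsingleton := by
      intro x _ y _
      have h1 := hsmooth x y
      have h2 := hfo x y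
      have h3 : ‖y - x‖ ^ 2 ≤ 0 := by nlinarith [sq_nonneg ‖y - x‖]
      have h4 : ‖y - x‖ = 0 := by
        have := sq_nonneg ‖y - x‖
        exact pow_eq_zero_iff (two_ne_zero) |>.1 (le_antisymm h3 this)
      exact (sub_eq_zero.1 (norm_eq_zero.1 h4)).symm
    rw [Metric.diam_subsingleton hsub] at hD
    linarith
  have hC : 0 ≤ C := by positivity
  have hdist : ∀ x ∈ convexHull ℝ V, ∀ y ∈ convexHull ℝ V, ‖x - y‖ ≤ D := by
    intro x hx y hy
    rw [← dist_eq_norm, ← hD]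
    exact Metric.dist_le_diam_of_mem (isBounded_convexHull.2 hVcpt.isBounded) hx hy
  have hVP : V ⊆ convexHull ℝ V := subset_convexHull ℝ V
  have hSP : ∀ t, ∀ v ∈ run.S t, v ∈ convexHull ℝ V := fun t v hv =>
    hVP (run.S_subset t hv)
  have hxP : ∀ t, run.x t ∈ convexHull ℝ V := by
    intro t
    rw [run.x_eq t]
    exact (convex_convexHull ℝ V).sum_mem (fun v hv => (run.c_pos t v hv).le) (run.c_sum t)
      (hSP t)
  have hgap : ∀ t, f (run.x t) - f xstar ≤ ⟪g (run.x t), run.x t - run.w t⟫ := by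
    intro t
    have h1 := hfo (run.x t) xstar
    have h2 : ⟪g (run.x t), run.w t⟫ ≤ ⟪g (run.x t), xstar⟫ := by
      have hcv : Convex ℝ {y | ⟪g (run.x t), run.w t⟫ ≤ ⟪g (run.x t), y⟫} :=
        convex_halfSpace_ge (innerSL ℝ (g (run.x t))).isLinear _
      exact convexHull_min (fun v hv => run.w_min t v hv) hcv hxstar
    rw [inner_sub_right] at h1 ⊢
    linarith
  have key : ∀ t : ℕ, ∃ k : ℕ, t + (run.S t).card ≤ 2 * k + 1 ∧
      (k : ℝ) * (f (run.x t) - f xstar) ≤ C := by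
    intro t
    induction t with
    | zero => exact ⟨0, by simp [run.init_S], by simpa using hC⟩
    | succ t ih =>
      obtain ⟨k, hk1, hk2⟩ := ih
      have hh : 0 ≤ f (run.x t) - f xstar := sub_nonneg.2 (hmin _ (hxP t))
      have hh' : 0 ≤ f (run.x (t + 1)) - f xstar := sub_nonneg.2 (hmin _ (hxP (t + 1)))
      rcases le_or_gt ⟪g (run.x t), run.x t - run.w t⟫ ⟪g (run.x t), run.a t - run.s t⟫ with hst | hst
      · obtain ⟨⟨hl0, hl1⟩, hls, hx, hS1, hS2, -⟩ := run.step_pairwise t hst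
        have hmono : f (run.x (t + 1)) ≤ f (run.x t) := by
          have := hls 0 ⟨le_rfl, (run.c_pos t _ (run.a_mem t)).le⟩
          simpa [hx] using this
        rcases hl1.lt_or_eq with hlt | heq
        · refine ⟨k + 1, by rw [hS1 hlt]; omega, ?_⟩
          have hp := bpcg_progress f g L D hL hconv hsmooth (run.x t) (run.a t - run.s t)
            (run.lam t) _ (f xstar) (hdist _ (hSP t _ (run.a_mem t)) _ (hSP t _ (run.s_mem t)))
            hl0 hlt hls (by linarith) ((hgap t).trans hst)
          rw [← hx] at hp
          push_cast
          exact bpcg_recursion C _ _ k hC hh' hh (by linarith) (by positivity) hk2 hp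
        · refine ⟨k, ?_, ?_⟩
          · have := @Finset.card_erase_add_one _ _ _ (fun a b => Classical.propDecidable (a = b)) (run.a_mem t)
            rw [← hS2 heq] at this
            omega
          · refine le_trans ?_ hk2
            gcongr
      · obtain ⟨⟨hl0, hl1⟩, hls, hx, hS, hc⟩ := run.step_fw t hst
        have hmono : f (run.x (t + 1)) ≤ f (run.x t) := by
          have := hls 0 ⟨le_rfl, zero_le_one⟩
          simpa [hx] using this
        have hlt : run.lam t < 1 := by
          refine lt_of_le_of_ne hl1 fun h1 => ?_
          have hall : ∀ v ∈ run.S t, v = run.w t := by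
            intro v hv
            by_contra hne
            have := run.c_pos (t + 1) v (by rw [hS]; exact @Finset.mem_insert_of_mem _ (fun a b => Classical.propDecidable (a = b)) _ _ _ hv)
            rw [hc v, h1] at this
            simp [hne] at this
          have hxw : run.x t = run.w t := by
            rw [run.x_eq t, Finset.sum_congr rfl (fun v hv => by rw [hall v hv] :
              ∀ v ∈ run.S t, run.c t v • v = run.c t v • run.w t), ← Finset.sum_smul,
              run.c_sum t, one_smul]
          rw [hall _ (run.a_mem t), hall _ (run.s_mem t), hxw] at hst
          simp at hst
        refine ⟨k + 1, ?_, ?_⟩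
        · have := @Finset.card_insert_le _ (fun a b => Classical.propDecidable (a = b)) (run.w t) (run.S t)
          rw [hS]
          omega
        · have hp := bpcg_progress f g L D hL hconv hsmooth (run.x t) (run.x t - run.w t)
            (run.lam t) _ (f xstar) (hdist _ (hxP t) _ (hVP (run.w_mem t)))
            hl0 hlt hls (by linarith) (hgap t)
          rw [← hx] at hp
          push_cast
          exact bpcg_recursion C _ _ k hC hh' hh (by linarith) (by positivity) hk2 hp
  obtain ⟨k, hk1, hk2⟩ := key T
  have hcard : 1 ≤ (run.S T).card := Finset.card_pos.2 ⟨_, run.a_mem T⟩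
  have hTk : (T : ℝ) ≤ 2 * k := by
    have : T ≤ 2 * k := by omega
    exact_mod_cast this
  have hh : 0 ≤ f (run.x T) - f xstar := sub_nonneg.2 (hmin _ (hxP T))
  have hTpos : (0 : ℝ) < T := by exact_mod_cast hT
  rw [le_div_iff₀ hTpos]
  have := mul_le_mul_of_nonneg_right hTk hh
  linarith
end
end

section
/- Let V ⊆ ℝ^d be a finite set, P = conv(V) a polytope of diameter D > 0, and let f : ℝ^d → ℝ be differentiable, μ-strongly convex and L-smooth, with x* the minimizer of f over P. Let δ > 0 be a constant such that along the given BPCG run on (f, V) the geometric strong convexity bound f(x_t) − f(x*) ≤ ⟨∇f(x_t), a_t − w_t⟩² / (2μδ²) holds at every step t (this holds when δ is the pyramidal width of P). Then for every integer T ≥ 0, f(x_T) − f(x*) ≤ (f(x_0) − f(x*)) · exp(−c_{f,P} T), where c_{f,P} = (1/2) · min{ 1/2, μδ²/(4LD²) }. (Theorem 3.2) -/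
open scoped RealInnerProductSpace BigOperators

attribute [local instance] Classical.propDecidable

noncomputable section

variable {H : Type*} [NormedAddCommGroup H] [InnerProductSpace ℝ H]

theorem bpcg_line_progress (f : H → ℝ) (g : H → H) (L D : ℝ) (hL : 0 < L) (hD : 0 < D)
    (hsmooth : ∀ x y, f y - f x - ⟪g x, y - x⟫ ≤ L / 2 * ‖y - x‖ ^ 2)
    (x d : H) (hd : ‖d‖ ≤ D) (r : ℝ) :
    f (x - r • d) ≤ f x - r * ⟪g x, d⟫ + L * D ^ 2 / 2 * r ^ 2 := by
  have h := hsmooth x (x - r • d)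
  have e : x - r • d - x = -(r • d) := by abel
  rw [e, inner_neg_right, inner_smul_right, norm_neg, norm_smul, mul_pow, Real.norm_eq_abs,
    sq_abs] at h
  have h2 : ‖d‖ ^ 2 ≤ D ^ 2 := by gcongr
  have h3 : L / 2 * (r ^ 2 * ‖d‖ ^ 2) ≤ L / 2 * (r ^ 2 * D ^ 2) := by gcongr
  nlinarith

/-- A line-search minimizer in the interior side of the right end is a global one on the right. -/
theorem bpcg_interior_min (f : H → ℝ) (g : H → H)
    (hconv : ∀ x y, 0 ≤ f y - f x - ⟪g x, y - x⟫)
    (x d : H) (l b : ℝ) (hl : l < b) (hb : f (x - l • d) ≤ f (x - b • d))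
    (r : ℝ) (hr : b ≤ r) : f (x - l • d) ≤ f (x - r • d) := by
  have h1 := hconv (x - b • d) (x - l • d)
  have h2 := hconv (x - b • d) (x - r • d)
  have e1 : x - l • d - (x - b • d) = (b - l) • d := by rw [sub_smul]; abel
  have e2 : x - r • d - (x - b • d) = (b - r) • d := by rw [sub_smul]; abel
  rw [e1, inner_smul_right] at h1
  rw [e2, inner_smul_right] at h2
  have h3 : ⟪g (x - b • d), d⟫ ≤ 0 := by
    by_contra hc
    push Not at hc
    have := mul_pos (sub_pos.2 hl) hc
    linarith
  nlinarith

theorem bpcg_step (V : Set H) (hVfin : V.Finite)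
    (D L μ δ : ℝ) (hD : Metric.diam (convexHull ℝ V) = D) (hDpos : 0 < D)
    (hL : 0 < L) (hμ : 0 < μ) (hδ : 0 < δ)
    (f : H → ℝ) (g : H → H)
    (hsmooth : ∀ x y, f y - f x - ⟪g x, y - x⟫ ≤ L / 2 * ‖y - x‖ ^ 2)
    (hstrong : ∀ x y, μ / 2 * ‖y - x‖ ^ 2 ≤ f y - f x - ⟪g x, y - x⟫)
    (xstar : H) (hxstar : xstar ∈ convexHull ℝ V)
    (hmin : ∀ y ∈ convexHull ℝ V, f xstar ≤ f y)
    (run : BPCGRun f g V)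
    (t : ℕ)
    (hgeo : f (run.x t) - f xstar ≤
      ⟪g (run.x t), run.a t - run.w t⟫ ^ 2 / (2 * μ * δ ^ 2)) :
    0 ≤ f (run.x t) - f xstar ∧
    ((f (run.x (t + 1)) - f xstar ≤
        (1 - min (1 / 2) (μ * δ ^ 2 / (4 * L * D ^ 2))) * (f (run.x t) - f xstar) ∧
      (run.S (t + 1)).card ≤ (run.S t).card + 1) ∨
    (f (run.x (t + 1)) ≤ f (run.x t) ∧ (run.S (t + 1)).card + 1 = (run.S t).card)) := by
  have hconv : ∀ x y, 0 ≤ f y - f x - ⟪g x, y - x⟫ := fun x y =>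
    le_trans (by positivity) (hstrong x y)
  have hbdd : Bornology.IsBounded (convexHull ℝ V) := isBounded_convexHull.2 hVfin.isBounded
  have hdist : ∀ p ∈ convexHull ℝ V, ∀ q ∈ convexHull ℝ V, ‖p - q‖ ≤ D := by
    intro p hp q hq
    rw [← hD, ← dist_eq_norm]
    exact Metric.dist_le_diam_of_mem hbdd hp hq
  have hVsub : V ⊆ convexHull ℝ V := subset_convexHull ℝ V
  have hxP : run.x t ∈ convexHull ℝ V := by
    rw [run.x_eq t]
    exact (convex_convexHull ℝ V).sum_mem (fun v hv => (run.c_pos t v hv).le) (run.c_sum t)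
      (fun v hv => hVsub (run.S_subset t hv))
  have haV := run.S_subset t (run.a_mem t)
  have hsV := run.S_subset t (run.s_mem t)
  have hwV := run.w_mem t
  -- s is at most x in gradient direction
  have hsx : ⟪g (run.x t), run.s t⟫ ≤ ⟪g (run.x t), run.x t⟫ := by
    have hx : ⟪g (run.x t), run.x t⟫ = ⟪g (run.x t), ∑ v ∈ run.S t, run.c t v • v⟫ :=
      congrArg (fun z => ⟪g (run.x t), z⟫) (run.x_eq t)
    rw [hx, inner_sum]
    calc ⟪g (run.x t), run.s t⟫ = ∑ v ∈ run.S t, run.c t v * ⟪g (run.x t), run.s t⟫ := by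
          rw [← Finset.sum_mul, run.c_sum t, one_mul]
      _ ≤ _ := by
          refine Finset.sum_le_sum fun v hv => ?_
          rw [inner_smul_right]
          exact mul_le_mul_of_nonneg_left (run.s_min t v hv) (run.c_pos t v hv).le
  have hwstar : ⟪g (run.x t), run.w t⟫ ≤ ⟪g (run.x t), xstar⟫ := by
    have hc : Convex ℝ {y : H | ⟪g (run.x t), run.w t⟫ ≤ ⟪g (run.x t), y⟫} :=
      convex_halfSpace_ge (innerSL ℝ (g (run.x t))).toLinearMap.isLinear _
    exact convexHull_min (fun v hv => run.w_min t v hv) hc hxstar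
  have hwa := run.w_min t _ haV
  have hh0 : 0 ≤ f (run.x t) - f xstar := sub_nonneg.2 (hmin _ hxP)
  refine ⟨hh0, ?_⟩
  set h := f (run.x t) - f xstar with hh
  have hgap : h ≤ ⟪g (run.x t), run.x t - run.w t⟫ := by
    have := hconv (run.x t) xstar
    rw [inner_sub_right] at this ⊢
    linarith
  have hq0 : 0 ≤ ⟪g (run.x t), run.a t - run.w t⟫ := by
    rw [inner_sub_right]; linarith
  have hsum : ⟪g (run.x t), run.a t - run.w t⟫ ≤
      ⟪g (run.x t), run.a t - run.s t⟫ + ⟪g (run.x t), run.x t - run.w t⟫ := by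
    simp only [inner_sub_right]; linarith
  have hgeo' : h * (2 * μ * δ ^ 2) ≤ ⟪g (run.x t), run.a t - run.w t⟫ ^ 2 :=
    (le_div_iff₀ (by positivity)).1 hgeo
  -- main progress estimate
  have key : ∀ G : ℝ, ⟪g (run.x t), run.a t - run.w t⟫ ≤ 2 * G →
      f (run.x (t + 1)) ≤ f (run.x t) - (G / (L * D ^ 2)) * G
        + L * D ^ 2 / 2 * (G / (L * D ^ 2)) ^ 2 →
      f (run.x (t + 1)) - f xstar ≤
        (1 - min (1 / 2) (μ * δ ^ 2 / (4 * L * D ^ 2))) * h := by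
    intro G hG hf
    have hLD : 0 < L * D ^ 2 := by positivity
    have e : (G / (L * D ^ 2)) * G - L * D ^ 2 / 2 * (G / (L * D ^ 2)) ^ 2
        = G ^ 2 / (2 * L * D ^ 2) := by
      field_simp
      ring
    have h1 : ⟪g (run.x t), run.a t - run.w t⟫ ^ 2 ≤ (2 * G) ^ 2 := by gcongr
    have h2 : μ * δ ^ 2 / (4 * L * D ^ 2) * h ≤ G ^ 2 / (2 * L * D ^ 2) := by
      rw [div_mul_eq_mul_div, div_le_div_iff₀ (by positivity) (by positivity)]
      have : μ * δ ^ 2 * h ≤ 2 * G ^ 2 := by nlinarith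
      have := mul_le_mul_of_nonneg_right this (show 0 ≤ 2 * L * D ^ 2 by positivity)
      linarith
    have h3 : min (1 / 2) (μ * δ ^ 2 / (4 * L * D ^ 2)) * h
        ≤ μ * δ ^ 2 / (4 * L * D ^ 2) * h :=
      mul_le_mul_of_nonneg_right (min_le_right _ _) hh0
    linarith
  have hLD : 0 < L * D ^ 2 := by positivity
  by_cases hp : ⟪g (run.x t), run.x t - run.w t⟫ ≤ ⟪g (run.x t), run.a t - run.s t⟫
  · obtain ⟨hl, hlmin, hx, hS1, hS2, -⟩ := run.step_pairwise t hp
    rcases hl.2.lt_or_eq with hlt | heq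
    · left
      refine ⟨?_, by rw [hS1 hlt]; omega⟩
      apply key ⟪g (run.x t), run.a t - run.s t⟫ (by linarith)
      refine le_trans ?_ (bpcg_line_progress f g L D hL hDpos hsmooth (run.x t)
        (run.a t - run.s t) (hdist _ (hVsub haV) _ (hVsub hsV)) _)
      rw [hx]
      have hr0 : 0 ≤ ⟪g (run.x t), run.a t - run.s t⟫ / (L * D ^ 2) :=
        div_nonneg (by linarith) hLD.le
      rcases le_total (⟪g (run.x t), run.a t - run.s t⟫ / (L * D ^ 2))
        (run.c t (run.a t)) with hr | hr
      · exact hlmin _ ⟨hr0, hr⟩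
      · exact bpcg_interior_min f g hconv _ _ _ _ hlt
          (hlmin _ ⟨hl.1.trans hl.2, le_rfl⟩) _ hr
    · right
      refine ⟨?_, by rw [hS2 heq]; exact Finset.card_erase_add_one (run.a_mem t)⟩
      have := hlmin 0 ⟨le_rfl, hl.1.trans hl.2⟩
      rw [hx]
      simpa using this
  · push Not at hp
    obtain ⟨hl, hlmin, hx, hS, -⟩ := run.step_fw t hp
    left
    refine ⟨?_, by rw [hS]; exact Finset.card_insert_le _ _⟩
    have hprog := bpcg_line_progress f g L D hL hDpos hsmooth (run.x t)
        (run.x t - run.w t) (hdist _ hxP _ (hVsub hwV))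
    rcases le_total (⟪g (run.x t), run.x t - run.w t⟫ / (L * D ^ 2)) 1 with hr | hr
    · apply key ⟪g (run.x t), run.x t - run.w t⟫ (by linarith)
      refine le_trans ?_ (hprog _)
      rw [hx]
      exact hlmin _ ⟨div_nonneg (by linarith) hLD.le, hr⟩
    · rw [le_div_iff₀ hLD] at hr
      have h1 := hlmin 1 ⟨zero_le_one, le_rfl⟩
      have h2 := hprog 1
      rw [← hx] at h1
      have h3 : min (1 / 2) (μ * δ ^ 2 / (4 * L * D ^ 2)) * h ≤ 1 / 2 * h :=
        mul_le_mul_of_nonneg_right (min_le_left _ _) hh0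
      linarith

/-- **Theorem 3.2.** Let `V ⊆ ℝ^d` be finite, `P = conv(V)` a polytope of diameter `D > 0`,
`f` differentiable, `μ`-strongly convex and `L`-smooth with minimizer `x*` over `P`, and let
`δ > 0` be such that the geometric strong convexity bound
`f(x_t) - f(x*) ≤ ⟪∇f(x_t), a_t - w_t⟫² / (2μδ²)` holds along the run (as is the case when
`δ` is the pyramidal width of `P`).  Then
`f(x_T) - f(x*) ≤ (f(x_0) - f(x*))·exp(-c_{f,P}·T)` with
`c_{f,P} = (1/2)·min {1/2, μδ²/(4LD²)}`. -/
theorem bpcg_convergence_strongly_convex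
    {d : ℕ} (V : Set (EuclideanSpace ℝ (Fin d))) (hVfin : V.Finite)
    (D L μ δ : ℝ) (hD : Metric.diam (convexHull ℝ V) = D) (hDpos : 0 < D)
    (hL : 0 < L) (hμ : 0 < μ) (hδ : 0 < δ)
    (f : EuclideanSpace ℝ (Fin d) → ℝ)
    (g : EuclideanSpace ℝ (Fin d) → EuclideanSpace ℝ (Fin d))
    (hdiff : ∀ y, HasFDerivAt f (innerSL ℝ (g y)) y)
    (hsmooth : ∀ x y, f y - f x - ⟪g x, y - x⟫ ≤ L / 2 * ‖y - x‖ ^ 2)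
    (hstrong : ∀ x y, μ / 2 * ‖y - x‖ ^ 2 ≤ f y - f x - ⟪g x, y - x⟫)
    (xstar : EuclideanSpace ℝ (Fin d)) (hxstar : xstar ∈ convexHull ℝ V)
    (hmin : ∀ y ∈ convexHull ℝ V, f xstar ≤ f y)
    (run : BPCGRun f g V)
    (hgeo : ∀ t : ℕ, f (run.x t) - f xstar ≤
      ⟪g (run.x t), run.a t - run.w t⟫ ^ 2 / (2 * μ * δ ^ 2))
    (T : ℕ) :
    f (run.x T) - f xstar ≤
      (f (run.x 0) - f xstar) *
        Real.exp (-(1 / 2 * min (1 / 2) (μ * δ ^ 2 / (4 * L * D ^ 2))) * T) := by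
  have hstep := fun t => bpcg_step V hVfin D L μ δ hD hDpos hL hμ hδ f g hsmooth hstrong
    xstar hxstar hmin run t (hgeo t)
  set m := min (1 / 2) (μ * δ ^ 2 / (4 * L * D ^ 2)) with hm
  have hm0 : 0 ≤ m := le_min (by norm_num) (by positivity)
  have hh00 := (hstep 0).1
  have main : ∀ t : ℕ, f (run.x t) - f xstar ≤ (f (run.x 0) - f xstar) *
      Real.exp (-(1 / 2 * m) * ((t : ℝ) + ((run.S t).card : ℝ) - 1)) := by
    intro t
    induction t with
    | zero => simp [run.init_S]
    | succ t ih =>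
      obtain ⟨h0, ⟨h1, h2⟩ | ⟨h1, h2⟩⟩ := hstep t
      · have h2' : ((run.S (t + 1)).card : ℝ) ≤ (run.S t).card + 1 := by exact_mod_cast h2
        have he : 1 - m ≤ Real.exp (-m) := by
          have := Real.add_one_le_exp (-m)
          linarith
        calc _ ≤ (1 - m) * (f (run.x t) - f xstar) := h1
          _ ≤ Real.exp (-m) * (f (run.x t) - f xstar) := by gcongr
          _ ≤ Real.exp (-m) * ((f (run.x 0) - f xstar) *
              Real.exp (-(1 / 2 * m) * ((t : ℝ) + ((run.S t).card : ℝ) - 1))) := by gcongr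
          _ = (f (run.x 0) - f xstar) *
              Real.exp (-m + -(1 / 2 * m) * ((t : ℝ) + ((run.S t).card : ℝ) - 1)) := by
            rw [Real.exp_add]; ring
          _ ≤ _ := by
            apply mul_le_mul_of_nonneg_left _ hh00
            apply Real.exp_le_exp.2
            push_cast
            nlinarith
      · have h2' : ((run.S (t + 1)).card : ℝ) + 1 = (run.S t).card := by exact_mod_cast h2
        have e : ((t + 1 : ℕ) : ℝ) + ((run.S (t + 1)).card : ℝ) - 1
            = (t : ℝ) + ((run.S t).card : ℝ) - 1 := by push_cast; linarith
        rw [e]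
        linarith
  refine (main T).trans (mul_le_mul_of_nonneg_left (Real.exp_le_exp.2 ?_) hh00)
  have hc : (1 : ℝ) ≤ (run.S T).card := by
    exact_mod_cast Finset.card_pos.2 ⟨_, run.a_mem T⟩
  nlinarith
end
end

section
/- Let H be a real inner product space, f : H → ℝ differentiable and L-smooth with L > 0, x ∈ H, d ∈ H with d ≠ 0 and ‖d‖ ≤ D, and suppose 0 ≤ ⟨∇f(x), d⟩ ≤ L‖d‖² (i.e., the short step λ* = ⟨∇f(x), d⟩/(L‖d‖²) satisfies λ* ∈ [0,1]). Then f(x − λ* d) ≤ f(x) − ⟨∇f(x), d⟩²/(2LD²); in particular, inf_{λ ∈ [0,1]} f(x − λ d) ≤ f(x) − ⟨∇f(x), d⟩²/(2LD²). (Lemma 3.4(a), FW-step case) -/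
open scoped RealInnerProductSpace BigOperators

attribute [local instance] Classical.propDecidable

noncomputable section

variable {H : Type*} [NormedAddCommGroup H] [InnerProductSpace ℝ H]

/-- **Lemma 3.4(a), FW-step case.** If `f` is differentiable and `L`-smooth with `L > 0`,
`d ≠ 0`, `‖d‖ ≤ D`, and the short step `λ* = ⟪∇f(x), d⟫/(L‖d‖²)` lies in `[0,1]`, then
`f(x - λ* d) ≤ f(x) - ⟪∇f(x), d⟫²/(2LD²)`; in particular the minimum of `f(x - λ d)` over
`λ ∈ [0,1]` is at most `f(x) - ⟪∇f(x), d⟫²/(2LD²)`. -/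
theorem bpcg_progress_fw_short_step
    (f : H → ℝ) (g : H → H)
    (hdiff : ∀ y, HasFDerivAt f (innerSL ℝ (g y)) y)
    (L D : ℝ) (hL : 0 < L)
    (hsmooth : ∀ x y, f y - f x - ⟪g x, y - x⟫ ≤ L / 2 * ‖y - x‖ ^ 2)
    (x d : H) (hd : d ≠ 0) (hdD : ‖d‖ ≤ D)
    (hge : 0 ≤ ⟪g x, d⟫) (hle : ⟪g x, d⟫ ≤ L * ‖d‖ ^ 2) :
    f (x - (⟪g x, d⟫ / (L * ‖d‖ ^ 2)) • d) ≤ f x - ⟪g x, d⟫ ^ 2 / (2 * L * D ^ 2) ∧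
      sInf ((fun lam : ℝ => f (x - lam • d)) '' Set.Icc 0 1) ≤
        f x - ⟪g x, d⟫ ^ 2 / (2 * L * D ^ 2) := by
  have hn : 0 < ‖d‖ := norm_pos_iff.mpr hd
  have hn2 : 0 < L * ‖d‖ ^ 2 := by positivity
  have key : f (x - (⟪g x, d⟫ / (L * ‖d‖ ^ 2)) • d) ≤
      f x - ⟪g x, d⟫ ^ 2 / (2 * L * D ^ 2) := by
    have h := hsmooth x (x - (⟪g x, d⟫ / (L * ‖d‖ ^ 2)) • d)
    have e : x - (⟪g x, d⟫ / (L * ‖d‖ ^ 2)) • d - x = -((⟪g x, d⟫ / (L * ‖d‖ ^ 2)) • d) := by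
      abel
    rw [e, inner_neg_right, inner_smul_right, norm_neg, norm_smul, mul_pow, Real.norm_eq_abs,
      sq_abs] at h
    generalize f (x - (⟪g x, d⟫ / (L * ‖d‖ ^ 2)) • d) = F at h ⊢
    generalize ⟪g x, d⟫ = a at *
    have h1 : a ^ 2 / (2 * L * D ^ 2) ≤ a ^ 2 / (2 * L * ‖d‖ ^ 2) := by gcongr
    have h2 : L / 2 * ((a / (L * ‖d‖ ^ 2)) ^ 2 * ‖d‖ ^ 2) - a / (L * ‖d‖ ^ 2) * a
        = - (a ^ 2 / (2 * L * ‖d‖ ^ 2)) := by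
      field_simp
      ring
    linarith
  refine ⟨key, le_trans (csInf_le ?_ ?_) key⟩
  · have hf : Continuous f := continuous_iff_continuousAt.mpr fun y => (hdiff y).continuousAt
    exact (isCompact_Icc.image (by fun_prop)).bddBelow
  · exact ⟨_, ⟨div_nonneg hge hn2.le, (div_le_one hn2).mpr hle⟩, rfl⟩
end
end

section
/- Let H be a real inner product space, f : H → ℝ differentiable, convex and L-smooth with L > 0, x ∈ H, d ∈ H with d ≠ 0 and ‖d‖ ≤ D, ⟨∇f(x), d⟩ ≥ 0, and Λ > 0. Suppose λ̂ ∈ [0, Λ] satisfies f(x − λ̂ d) ≤ f(x − λ d) for all λ ∈ [0, Λ], and λ̂ < Λ. Then f(x) − f(x − λ̂ d) ≥ ⟨∇f(x), d⟩²/(2LD²). (Lemma 3.4(a), descent-step case) -/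
open scoped RealInnerProductSpace BigOperators

attribute [local instance] Classical.propDecidable

noncomputable section

variable {H : Type*} [NormedAddCommGroup H] [InnerProductSpace ℝ H]

/-- **Lemma 3.4(a), descent-step case.** If `f` is differentiable, convex and `L`-smooth
with `L > 0`, `d ≠ 0`, `‖d‖ ≤ D`, `⟪∇f(x), d⟫ ≥ 0`, and `λ̂ ∈ [0, Λ]` minimizes
`λ ↦ f(x - λ d)` over `[0, Λ]` with `λ̂ < Λ`, then
`f(x) - f(x - λ̂ d) ≥ ⟪∇f(x), d⟫²/(2LD²)`. -/
theorem bpcg_progress_descent_step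
    (f : H → ℝ) (g : H → H)
    (hdiff : ∀ y, HasFDerivAt f (innerSL ℝ (g y)) y)
    (hconv : ConvexOn ℝ Set.univ f)
    (L D : ℝ) (hL : 0 < L)
    (hsmooth : ∀ x y, f y - f x - ⟪g x, y - x⟫ ≤ L / 2 * ‖y - x‖ ^ 2)
    (x d : H) (hd : d ≠ 0) (hdD : ‖d‖ ≤ D) (hge : 0 ≤ ⟪g x, d⟫)
    (Λ : ℝ) (hΛ : 0 < Λ) (lamhat : ℝ) (hmem : lamhat ∈ Set.Icc (0 : ℝ) Λ)
    (hopt : ∀ lam ∈ Set.Icc (0 : ℝ) Λ, f (x - lamhat • d) ≤ f (x - lam • d))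
    (hlt : lamhat < Λ) :
    f x - f (x - lamhat • d) ≥ ⟪g x, d⟫ ^ 2 / (2 * L * D ^ 2) := by
  have hglob : ∀ t : ℝ, 0 ≤ t → f (x - lamhat • d) ≤ f (x - t • d) := by
    intro t ht
    by_cases htΛ : t ≤ Λ
    · exact hopt t ⟨ht, htΛ⟩
    · have h1 : Λ < t := not_le.mp htΛ
      have hpos : 0 < t - lamhat := by linarith
      set s : ℝ := (Λ - lamhat) / (t - lamhat) with hs
      have hs0 : 0 < s := div_pos (by linarith) hpos
      have hs1 : s ≤ 1 := by
        rw [hs, div_le_one hpos]; linarith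
      have hsm : s * (t - lamhat) = Λ - lamhat := by
        rw [hs]; field_simp
      have hc := hconv.2 (Set.mem_univ (x - lamhat • d)) (Set.mem_univ (x - t • d))
        (sub_nonneg.mpr hs1) hs0.le (by ring)
      have he : (1 - s) • (x - lamhat • d) + s • (x - t • d) = x - Λ • d := by
        have : Λ = lamhat + s * (t - lamhat) := by linarith
        rw [this]
        module
      rw [he] at hc
      have h2 := hopt Λ ⟨hΛ.le, le_refl _⟩
      simp only [smul_eq_mul] at hc
      have h3 : s * f (x - lamhat • d) ≤ s * f (x - t • d) := by linarith
      exact le_of_mul_le_mul_left h3 hs0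
  have hdpos : 0 < ‖d‖ := norm_pos_iff.mpr hd
  set a : ℝ := ⟪g x, d⟫ with ha
  have hLd : 0 < L * ‖d‖ ^ 2 := by positivity
  have h1 := hglob (a / (L * ‖d‖ ^ 2)) (div_nonneg hge hLd.le)
  have h2 := hsmooth x (x - (a / (L * ‖d‖ ^ 2)) • d)
  have he : x - (a / (L * ‖d‖ ^ 2)) • d - x = -((a / (L * ‖d‖ ^ 2)) • d) := by abel
  rw [he, inner_neg_right, real_inner_smul_right, ← ha, norm_neg, norm_smul, mul_pow,
    Real.norm_eq_abs, sq_abs] at h2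
  have h3 : -(-(a / (L * ‖d‖ ^ 2) * a)) - L / 2 * ((a / (L * ‖d‖ ^ 2)) ^ 2 * ‖d‖ ^ 2)
      = a ^ 2 / (2 * L * ‖d‖ ^ 2) := by
    field_simp
    ring
  have h4 : a ^ 2 / (2 * L * D ^ 2) ≤ a ^ 2 / (2 * L * ‖d‖ ^ 2) := by
    gcongr
  linarith
end
end

section
/- Let H be a real inner product space, f : H → ℝ differentiable, S ⊆ H a finite nonempty set, x ∈ conv(S), and let a ∈ S satisfy ⟨∇f(x), a⟩ ≥ ⟨∇f(x), v⟩ for all v ∈ S, and s ∈ S satisfy ⟨∇f(x), s⟩ ≤ ⟨∇f(x), v⟩ for all v ∈ S. Let w ∈ H. If ⟨∇f(x), a − s⟩ ≥ ⟨∇f(x), x − w⟩, then 2⟨∇f(x), a − s⟩ ≥ ⟨∇f(x), a − w⟩. (Lemma 3.5, pairwise-step case) -/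
open scoped RealInnerProductSpace BigOperators

attribute [local instance] Classical.propDecidable

noncomputable section

variable {H : Type*} [NormedAddCommGroup H] [InnerProductSpace ℝ H]

/-- **Lemma 3.5, pairwise-step case.** If `⟪∇f(x), a - s⟫ ≥ ⟪∇f(x), x - w⟫`, then
`2⟪∇f(x), a - s⟫ ≥ ⟪∇f(x), a - w⟫`. -/
theorem bpcg_gap_pairwise_step
    (f : H → ℝ) (g : H → H)
    (hdiff : ∀ y, HasFDerivAt f (innerSL ℝ (g y)) y)
    (S : Finset H) (hS : S.Nonempty)
    (x : H) (hx : x ∈ convexHull ℝ (S : Set H))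
    (a : H) (ha : a ∈ S) (hamax : ∀ v ∈ S, ⟪g x, v⟫ ≤ ⟪g x, a⟫)
    (s : H) (hs : s ∈ S) (hsmin : ∀ v ∈ S, ⟪g x, s⟫ ≤ ⟪g x, v⟫)
    (w : H)
    (hcond : ⟪g x, a - s⟫ ≥ ⟪g x, x - w⟫) :
    2 * ⟪g x, a - s⟫ ≥ ⟪g x, a - w⟫ := by
  have h : ⟪g x, s⟫ ≤ ⟪g x, x⟫ := by
    have hsub : convexHull ℝ (S : Set H) ⊆ {y | ⟪g x, s⟫ ≤ ⟪g x, y⟫} :=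
      convexHull_min (fun v hv => hsmin v (by simpa using hv))
        (convex_halfSpace_ge (innerSL ℝ (g x)).isLinear _)
    exact hsub hx
  simp only [inner_sub_right] at *
  linarith
end
end

section
/- Let H be a real inner product space, f : H → ℝ differentiable, S ⊆ H a finite nonempty set, x ∈ conv(S), and let a ∈ S satisfy ⟨∇f(x), a⟩ ≥ ⟨∇f(x), v⟩ for all v ∈ S, and s ∈ S satisfy ⟨∇f(x), s⟩ ≤ ⟨∇f(x), v⟩ for all v ∈ S. Let w ∈ H and let K ≥ 1 be a real scaling factor. If K·⟨∇f(x), a − s⟩ ≥ ⟨∇f(x), x − w⟩, then (K+1)·⟨∇f(x), a − s⟩ ≥ ⟨∇f(x), a − w⟩. (Modified version of Lemma 3.5 with sparsity-control factor K, pairwise-step case) -/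
open scoped RealInnerProductSpace BigOperators

attribute [local instance] Classical.propDecidable

noncomputable section

variable {H : Type*} [NormedAddCommGroup H] [InnerProductSpace ℝ H]

/-- **Modified Lemma 3.5 with sparsity-control factor `K ≥ 1`, pairwise-step case.**
If `K·⟪∇f(x), a - s⟫ ≥ ⟪∇f(x), x - w⟫`, then `(K+1)·⟪∇f(x), a - s⟫ ≥ ⟪∇f(x), a - w⟫`. -/
theorem bpcg_gap_pairwise_step_scaled
    (f : H → ℝ) (g : H → H)
    (hdiff : ∀ y, HasFDerivAt f (innerSL ℝ (g y)) y)
    (S : Finset H) (hS : S.Nonempty)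
    (x : H) (hx : x ∈ convexHull ℝ (S : Set H))
    (a : H) (ha : a ∈ S) (hamax : ∀ v ∈ S, ⟪g x, v⟫ ≤ ⟪g x, a⟫)
    (s : H) (hs : s ∈ S) (hsmin : ∀ v ∈ S, ⟪g x, s⟫ ≤ ⟪g x, v⟫)
    (w : H)
    (K : ℝ) (hK : 1 ≤ K) (hcond : K * ⟪g x, a - s⟫ ≥ ⟪g x, x - w⟫) :
    (K + 1) * ⟪g x, a - s⟫ ≥ ⟪g x, a - w⟫ := by
  have hsx : ⟪g x, s⟫ ≤ ⟪g x, x⟫ := by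
    have hconv : Convex ℝ {y : H | ⟪g x, s⟫ ≤ innerSL ℝ (g x) y} :=
      convex_halfSpace_ge (innerSL ℝ (g x)).toLinearMap.isLinear _
    have hsub : (S : Set H) ⊆ {y : H | ⟪g x, s⟫ ≤ innerSL ℝ (g x) y} := by
      intro v hv
      simpa using hsmin v hv
    simpa only [Set.mem_setOf_eq, innerSL_apply_apply] using convexHull_min hsub hconv hx
  simp only [inner_sub_right] at *
  linarith
end
end

section
/- Let H be a real inner product space, f : H → ℝ differentiable, S ⊆ H a finite nonempty set, x ∈ conv(S), and let a ∈ S satisfy ⟨∇f(x), a⟩ ≥ ⟨∇f(x), v⟩ for all v ∈ S, and s ∈ S satisfy ⟨∇f(x), s⟩ ≤ ⟨∇f(x), v⟩ for all v ∈ S. Let w ∈ H and let K ≥ 1 be a real scaling factor. If K·⟨∇f(x), a − s⟩ < ⟨∇f(x), x − w⟩, then ⟨∇f(x), a − w⟩ < (K+1)·⟨∇f(x), x − w⟩. (Modified version of Lemma 3.5 with sparsity-control factor K, FW-step case) -/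
open scoped RealInnerProductSpace BigOperators

attribute [local instance] Classical.propDecidable

noncomputable section

variable {H : Type*} [NormedAddCommGroup H] [InnerProductSpace ℝ H]

/-- **Modified Lemma 3.5 with sparsity-control factor `K ≥ 1`, FW-step case.**
If `K·⟪∇f(x), a - s⟫ < ⟪∇f(x), x - w⟫`, then `⟪∇f(x), a - w⟫ < (K+1)·⟪∇f(x), x - w⟫`. -/
theorem bpcg_gap_fw_step_scaled
    (f : H → ℝ) (g : H → H)
    (hdiff : ∀ y, HasFDerivAt f (innerSL ℝ (g y)) y)
    (S : Finset H) (hS : S.Nonempty)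
    (x : H) (hx : x ∈ convexHull ℝ (S : Set H))
    (a : H) (ha : a ∈ S) (hamax : ∀ v ∈ S, ⟪g x, v⟫ ≤ ⟪g x, a⟫)
    (s : H) (hs : s ∈ S) (hsmin : ∀ v ∈ S, ⟪g x, s⟫ ≤ ⟪g x, v⟫)
    (w : H)
    (K : ℝ) (hK : 1 ≤ K) (hcond : K * ⟪g x, a - s⟫ < ⟪g x, x - w⟫) :
    ⟪g x, a - w⟫ < (K + 1) * ⟪g x, x - w⟫ := by
  have hsx : ⟪g x, s⟫ ≤ ⟪g x, x⟫ := by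
    have hconv : Convex ℝ {y : H | ⟪g x, s⟫ ≤ ⟪g x, y⟫} :=
      convex_halfSpace_ge (innerSL ℝ (g x)).toLinearMap.isLinear _
    exact convexHull_min (fun v hv => hsmin v hv) hconv hx
  have has := hamax s hs
  rw [inner_sub_right, inner_sub_right] at hcond
  rw [inner_sub_right, inner_sub_right]
  have h1 : 0 ≤ (K - 1) * (⟪g x, a⟫ - ⟪g x, s⟫) :=
    mul_nonneg (by linarith) (by linarith)
  have h2 : 0 ≤ (K - 1) * (⟪g x, x⟫ - ⟪g x, w⟫) :=
    mul_nonneg (by linarith) (by linarith)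
  linarith
end
end

section
/- Let P ⊆ ℝ^d be a compact convex set of diameter D > 0, f : ℝ^d → ℝ differentiable, convex and L-smooth, x* a minimizer of f over P, x ∈ P, and w ∈ P a minimizer of v ↦ ⟨∇f(x), v⟩ over P. Set h = f(x) − f(x*) and h' = min_{λ ∈ [0,1]} f(x − λ(x − w)) − f(x*). Then: if h ≤ LD², one has h' ≤ h − h²/(2LD²); and if h ≥ LD², one has h' ≤ LD²/2 ≤ h/2. (Frank-Wolfe step primal progress, inequalities (10)–(12) in the proof of Theorem 3.1) -/
open scoped RealInnerProductSpace BigOperators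

attribute [local instance] Classical.propDecidable

noncomputable section

variable {H : Type*} [NormedAddCommGroup H] [InnerProductSpace ℝ H]

/-- **FW-step primal progress (inequalities (10)–(12) in the proof of Theorem 3.1).**
With `h = f(x) - f(x*)` and `h' = min_{λ∈[0,1]} f(x - λ(x - w)) - f(x*)`: if `h ≤ LD²`
then `h' ≤ h - h²/(2LD²)`, and if `h ≥ LD²` then `h' ≤ LD²/2 ≤ h/2`. -/
theorem bpcg_fw_step_primal_progress
    {d : ℕ} (P : Set (EuclideanSpace ℝ (Fin d)))
    (hPcpt : IsCompact P) (hPconv : Convex ℝ P)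
    (D L : ℝ) (hD : Metric.diam P = D) (hDpos : 0 < D)
    (f : EuclideanSpace ℝ (Fin d) → ℝ)
    (g : EuclideanSpace ℝ (Fin d) → EuclideanSpace ℝ (Fin d))
    (hdiff : ∀ y, HasFDerivAt f (innerSL ℝ (g y)) y)
    (hconv : ConvexOn ℝ Set.univ f)
    (hsmooth : ∀ x y, f y - f x - ⟪g x, y - x⟫ ≤ L / 2 * ‖y - x‖ ^ 2)
    (xstar : EuclideanSpace ℝ (Fin d)) (hxstar : xstar ∈ P)
    (hmin : ∀ y ∈ P, f xstar ≤ f y)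
    (x : EuclideanSpace ℝ (Fin d)) (hx : x ∈ P)
    (w : EuclideanSpace ℝ (Fin d)) (hw : w ∈ P)
    (hwmin : ∀ v ∈ P, ⟪g x, w⟫ ≤ ⟪g x, v⟫)
    (h h' : ℝ) (hh : h = f x - f xstar)
    (hh' : h' = sInf ((fun lam : ℝ => f (x - lam • (x - w))) '' Set.Icc 0 1) - f xstar) :
    (h ≤ L * D ^ 2 → h' ≤ h - h ^ 2 / (2 * L * D ^ 2)) ∧
      (L * D ^ 2 ≤ h → h' ≤ L * D ^ 2 / 2 ∧ L * D ^ 2 / 2 ≤ h / 2) := by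
  have hgrad : ∀ a b, f a + ⟪g a, b - a⟫ ≤ f b := by
    intro a b
    have hc : ConvexOn ℝ Set.univ (fun t : ℝ => f (AffineMap.lineMap a b t)) := by
      have := hconv.comp_affineMap (AffineMap.lineMap (k := ℝ) a b)
      simpa [Function.comp_def] using this
    have hd : HasDerivAt (fun t : ℝ => f (AffineMap.lineMap a b t)) (⟪g a, b - a⟫) 0 := by
      have h1 : HasDerivAt (fun t : ℝ => AffineMap.lineMap (k := ℝ) a b t) (b - a) 0 :=
        AffineMap.hasDerivAt_lineMap
      have h2 : HasFDerivAt f (innerSL ℝ (g a)) (AffineMap.lineMap (k := ℝ) a b (0:ℝ)) := by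
        simpa using hdiff a
      have := h2.comp_hasDerivAt (0:ℝ) h1
      simpa [Function.comp_def] using this
    have := hc.le_slope_of_hasDerivAt (Set.mem_univ (0:ℝ)) (Set.mem_univ 1) zero_lt_one hd
    simp [slope] at this
    linarith
  have hL : 0 ≤ L := by
    by_contra hneg
    push Not at hneg
    have hs : P.Subsingleton := by
      intro a _ b _
      by_contra hab
      have h1 := hgrad b a
      have h2 := hsmooth b a
      have h3 : 0 < ‖a - b‖ ^ 2 := by
        have : 0 < ‖a - b‖ := norm_pos_iff.mpr (sub_ne_zero.mpr hab)
        positivity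
      nlinarith
    rw [Metric.diam_subsingleton hs] at hD
    linarith
  have hwx : ‖x - w‖ ^ 2 ≤ D ^ 2 := by
    have h1 := Metric.dist_le_diam_of_mem hPcpt.isBounded hx hw
    rw [hD, dist_eq_norm] at h1
    exact pow_le_pow_left₀ (norm_nonneg _) h1 2
  have hgap : h ≤ ⟪g x, x - w⟫ := by
    have h1 := hgrad x xstar
    have h2 := hwmin xstar hxstar
    simp only [inner_sub_right] at h1 ⊢
    linarith
  have hh0 : 0 ≤ h := by
    have := hmin x hx
    linarith
  have key : ∀ t : ℝ, 0 ≤ t → t ≤ 1 → h' ≤ h - t * h + L / 2 * (t ^ 2 * D ^ 2) := by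
    intro t ht0 ht1
    have hbdd : BddBelow ((fun lam : ℝ => f (x - lam • (x - w))) '' Set.Icc 0 1) := by
      refine ⟨f xstar, ?_⟩
      rintro _ ⟨s, ⟨hs0, hs1⟩, rfl⟩
      apply hmin
      have := hPconv hx hw (sub_nonneg.mpr hs1) hs0 (by ring)
      convert this using 1
      module
    have h1 := csInf_le hbdd ⟨t, ⟨ht0, ht1⟩, rfl⟩
    have h2 := hsmooth x (x - t • (x - w))
    have e : x - t • (x - w) - x = (-t) • (x - w) := by module
    rw [e, inner_smul_right, norm_smul, mul_pow, Real.norm_eq_abs, sq_abs, neg_sq] at h2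
    have h3 : t * h ≤ t * ⟪g x, x - w⟫ := mul_le_mul_of_nonneg_left hgap ht0
    have h4 : L / 2 * (t ^ 2 * ‖x - w‖ ^ 2) ≤ L / 2 * (t ^ 2 * D ^ 2) := by gcongr
    simp only at h1
    linarith
  refine ⟨fun hle => ?_, fun hge => ⟨?_, by linarith⟩⟩
  · rcases hL.eq_or_lt with h0 | hLpos
    · have := key 0 le_rfl zero_le_one
      subst h0
      simpa using this
    · have hp : 0 < L * D ^ 2 := by positivity
      have := key (h / (L * D ^ 2)) (by positivity) ((div_le_one hp).mpr hle)
      refine this.trans (le_of_eq ?_)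
      field_simp
      ring
  · have := key 1 zero_le_one le_rfl
    linarith
end
end

section
/- Let P ⊆ ℝ^d be a compact convex set of diameter D > 0, f : ℝ^d → ℝ differentiable, convex and L-smooth, x* a minimizer of f over P, x ∈ P, and w ∈ P a minimizer of v ↦ ⟨∇f(x), v⟩ over P. Let d ∈ ℝ^d satisfy d ≠ 0, ‖d‖ ≤ D, and ⟨∇f(x), d⟩ ≥ ⟨∇f(x), x − w⟩, and let x' = x − λ̂ d where λ̂ ∈ [0, Λ] minimizes λ ↦ f(x − λ d) over [0, Λ] for some Λ > 0 and λ̂ < Λ. Then f(x) − f(x') ≥ (f(x) − f(x*))² / (2LD²). (Descent-step primal progress, inequality (7) in the proof of Theorem 3.1) -/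
open scoped RealInnerProductSpace BigOperators

attribute [local instance] Classical.propDecidable

noncomputable section

variable {H : Type*} [NormedAddCommGroup H] [InnerProductSpace ℝ H]

/-- **Descent-step primal progress (inequality (7) in the proof of Theorem 3.1).**
If `d ≠ 0`, `‖d‖ ≤ D`, `⟪∇f(x), d⟫ ≥ ⟪∇f(x), x - w⟫` (the BPCG pairwise step-selection
condition), and `x' = x - λ̂ d` where `λ̂ ∈ [0, Λ]` minimizes `λ ↦ f(x - λ d)` over `[0, Λ]`
with `λ̂ < Λ`, then `f(x) - f(x') ≥ (f(x) - f(x*))²/(2LD²)`. -/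
theorem bpcg_descent_step_primal_progress
    {n : ℕ} (P : Set (EuclideanSpace ℝ (Fin n)))
    (hPcpt : IsCompact P) (hPconv : Convex ℝ P)
    (D L : ℝ) (hD : Metric.diam P = D) (hDpos : 0 < D)
    (f : EuclideanSpace ℝ (Fin n) → ℝ)
    (g : EuclideanSpace ℝ (Fin n) → EuclideanSpace ℝ (Fin n))
    (hdiff : ∀ y, HasFDerivAt f (innerSL ℝ (g y)) y)
    (hconv : ConvexOn ℝ Set.univ f)
    (hsmooth : ∀ x y, f y - f x - ⟪g x, y - x⟫ ≤ L / 2 * ‖y - x‖ ^ 2)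
    (xstar : EuclideanSpace ℝ (Fin n)) (hxstar : xstar ∈ P)
    (hmin : ∀ y ∈ P, f xstar ≤ f y)
    (x : EuclideanSpace ℝ (Fin n)) (hx : x ∈ P)
    (w : EuclideanSpace ℝ (Fin n)) (hw : w ∈ P)
    (hwmin : ∀ v ∈ P, ⟪g x, w⟫ ≤ ⟪g x, v⟫)
    (d : EuclideanSpace ℝ (Fin n)) (hd : d ≠ 0) (hdD : ‖d‖ ≤ D)
    (hsel : ⟪g x, d⟫ ≥ ⟪g x, x - w⟫)
    (Λ : ℝ) (hΛ : 0 < Λ) (lamhat : ℝ) (hmem : lamhat ∈ Set.Icc (0 : ℝ) Λ)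
    (hopt : ∀ lam ∈ Set.Icc (0 : ℝ) Λ, f (x - lamhat • d) ≤ f (x - lam • d))
    (hlt : lamhat < Λ) :
    f x - f (x - lamhat • d) ≥ (f x - f xstar) ^ 2 / (2 * L * D ^ 2) := by
  have hkey : f x + ⟪g x, xstar - x⟫ ≤ f xstar := by
    have hc : ConvexOn ℝ Set.univ (f ∘ (AffineMap.lineMap x xstar : ℝ →ᵃ[ℝ] _)) := by
      simpa using hconv.comp_affineMap (AffineMap.lineMap x xstar : ℝ →ᵃ[ℝ] _)
    have hl : HasDerivAt (AffineMap.lineMap x xstar : ℝ → _) (xstar - x) (0 : ℝ) :=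
      AffineMap.hasDerivAt_lineMap
    have hf0 : HasFDerivAt f (innerSL ℝ (g x))
        ((AffineMap.lineMap x xstar : ℝ → EuclideanSpace ℝ (Fin n)) 0) := by
      simpa using hdiff x
    have hder := hf0.comp_hasDerivAt (0 : ℝ) hl
    have h := hc.le_slope_of_hasDerivAt (Set.mem_univ 0) (Set.mem_univ 1) zero_lt_one hder
    simp [slope_def_field] at h
    linarith
  have hG : f x - f xstar ≤ ⟪g x, d⟫ := by
    have h1 := hwmin xstar hxstar
    rw [inner_sub_right] at hsel hkey
    linarith
  have h0 : f xstar ≤ f x := hmin x hx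
  have hx0 : f (x - lamhat • d) ≤ f x := by
    simpa using hopt 0 ⟨le_refl _, hΛ.le⟩
  rcases le_or_gt L 0 with hL | hL
  · have : (f x - f xstar) ^ 2 / (2 * L * D ^ 2) ≤ 0 :=
      div_nonpos_of_nonneg_of_nonpos (sq_nonneg _)
        (mul_nonpos_of_nonpos_of_nonneg (by linarith) (sq_nonneg _))
    linarith
  have hglob : ∀ t : ℝ, 0 ≤ t → f (x - lamhat • d) ≤ f (x - t • d) := by
    intro t ht
    rcases le_or_gt t Λ with h | h
    · exact hopt t ⟨ht, h⟩
    have hpos : 0 < t - lamhat := by linarith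
    have hs : 0 < (Λ - lamhat) / (t - lamhat) := div_pos (by linarith) hpos
    have hs1 : (Λ - lamhat) / (t - lamhat) ≤ 1 := (div_le_one hpos).2 (by linarith)
    have hse : (Λ - lamhat) / (t - lamhat) * (t - lamhat) = Λ - lamhat :=
      div_mul_cancel₀ _ hpos.ne'
    generalize (Λ - lamhat) / (t - lamhat) = s at hs hs1 hse
    have hc := hconv.2 (Set.mem_univ (x - lamhat • d)) (Set.mem_univ (x - t • d))
      (sub_nonneg.2 hs1) hs.le (by ring)
    have he : (1 - s) • (x - lamhat • d) + s • (x - t • d) = x - Λ • d := by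
      have : Λ = lamhat + s * (t - lamhat) := by linarith
      rw [this]; module
    rw [he] at hc
    have h2 := hopt Λ ⟨hΛ.le, le_refl _⟩
    simp only [smul_eq_mul] at hc
    have : 0 ≤ s * (f (x - t • d) - f (x - lamhat • d)) := by linarith
    linarith [nonneg_of_mul_nonneg_right this hs]
  set G := f x - f xstar with hGdef
  have hG0 : 0 ≤ G := by linarith
  have hden : 0 < L * D ^ 2 := by positivity
  have ht0 : 0 ≤ G / (L * D ^ 2) := by positivity
  have h1 := hglob _ ht0
  have h2 := hsmooth x (x - (G / (L * D ^ 2)) • d)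
  have he : x - (G / (L * D ^ 2)) • d - x = (-(G / (L * D ^ 2))) • d := by module
  rw [he, inner_smul_right, norm_smul, mul_pow, Real.norm_eq_abs, sq_abs] at h2
  have h3 : ‖d‖ ^ 2 ≤ D ^ 2 := by gcongr
  have h4 := mul_le_mul_of_nonneg_left hG ht0
  have h5 := mul_le_mul_of_nonneg_left h3
    (show 0 ≤ L / 2 * (-(G / (L * D ^ 2))) ^ 2 by positivity)
  have h6 : G / (L * D ^ 2) * G - L / 2 * (-(G / (L * D ^ 2))) ^ 2 * D ^ 2
      = G ^ 2 / (2 * L * D ^ 2) := by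
    field_simp
    ring
  linarith
end
end

section
/- Let Ω be a compact metric space, H a real Hilbert space, and φ : Ω → H a continuous map with ‖φ(x)‖ = 1 and ⟨φ(x), φ(y)⟩ ≥ 0 for all x, y ∈ Ω (the feature map of a kernel K(x,y) = ⟨φ(x), φ(y)⟩ with K(x,x) = 1 and K(x,y) ≥ 0). Let m belong to the closed convex hull P of φ(Ω), and let f : H → ℝ be given by f(z) = ‖z − m‖². Then for every BPCG run on (f, φ(Ω)) over P and every integer T ≥ 1, the iterate z_T = Σ_{x ∈ X_T} w_x φ(x) satisfies ‖z_T − m‖² ≤ 16/T. In particular, when m is the mean embedding of a probability measure μ, the squared maximum mean discrepancy of the quadrature measure ξ_T = Σ w_x δ_x produced by BPCG kernel herding satisfies γ_K(ξ_T, μ)² = O(1/T). (Theorem 4.1) -/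
open scoped RealInnerProductSpace BigOperators

attribute [local instance] Classical.propDecidable

noncomputable section

variable {H : Type*} [NormedAddCommGroup H] [InnerProductSpace ℝ H]

theorem bpcg_aux_dist (V : Set H) (hn : ∀ v ∈ V, ‖v‖ = 1)
    (hp : ∀ u ∈ V, ∀ v ∈ V, 0 ≤ ⟪u, v⟫) (z : H) (hz : z ∈ closure (convexHull ℝ V))
    (y : H) (hy : y ∈ V) : ‖z - y‖ ^ 2 ≤ 2 := by
  have h1 : closure (convexHull ℝ V) ⊆ Metric.closedBall y (Real.sqrt 2) := by
    apply closure_minimal _ Metric.isClosed_closedBall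
    apply convexHull_min _ (convex_closedBall _ _)
    intro v hv
    rw [mem_closedBall_iff_norm]
    apply Real.le_sqrt_of_sq_le
    rw [norm_sub_sq_real, hn v hv, hn y hy]
    have := hp v hv y hy
    linarith
  have h2 := h1 hz
  rw [mem_closedBall_iff_norm] at h2
  calc ‖z - y‖ ^ 2 ≤ Real.sqrt 2 ^ 2 := by gcongr
    _ = 2 := Real.sq_sqrt (by norm_num)

theorem bpcg_aux_lin (V : Set H) (g w : H) (hw : ∀ v ∈ V, ⟪g, w⟫ ≤ ⟪g, v⟫)
    (z : H) (hz : z ∈ closure (convexHull ℝ V)) : ⟪g, w⟫ ≤ ⟪g, z⟫ := by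
  have h1 : closure (convexHull ℝ V) ⊆ {v : H | ⟪g, w⟫ ≤ ⟪g, v⟫} := by
    apply closure_minimal
    · apply convexHull_min hw
      exact convex_halfSpace_ge (innerSL ℝ g).isLinear _
    · exact isClosed_le continuous_const (by fun_prop)
  exact h1 hz

theorem bpcg_aux_expand (x m d : H) (μ : ℝ) :
    ‖x - μ • d - m‖ ^ 2 = ‖x - m‖ ^ 2 - μ * ⟪(2 : ℝ) • (x - m), d⟫ + μ ^ 2 * ‖d‖ ^ 2 := by
  have : x - μ • d - m = (x - m) - μ • d := by abel
  rw [this, norm_sub_sq_real, norm_smul, inner_smul_left, inner_smul_right, mul_pow]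
  simp
  ring

/-- Value at the trial step `h / 2`. -/
theorem bpcg_aux_trial (h G D : ℝ) (hh : 0 ≤ h) (hG : 2 * h ≤ G) (hD : D ≤ 2) :
    h - (h / 2) * G + (h / 2) ^ 2 * D ≤ h - h ^ 2 / 2 := by
  have h1 := mul_le_mul_of_nonneg_left hG hh
  have h2 := mul_le_mul_of_nonneg_left hD (sq_nonneg h)
  nlinarith

/-- An interior minimizer of a convex quadratic is a minimizer to its right. -/
theorem bpcg_aux_interior (h G D l L μ : ℝ) (hD : 0 ≤ D) (hl : l < L) (hμ : L < μ)
    (hmin : h - l * G + l ^ 2 * D ≤ h - L * G + L ^ 2 * D) :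
    h - l * G + l ^ 2 * D ≤ h - μ * G + μ ^ 2 * D := by
  have h1 : 0 ≤ (L - l) * ((L + l) * D - G) := by linarith
  have h2 : 0 ≤ (L + l) * D - G := nonneg_of_mul_nonneg_right h1 (by linarith)
  have h3 : 0 ≤ (μ + l) * D - G := by nlinarith
  nlinarith [mul_nonneg (by linarith : 0 ≤ μ - l) h3]

theorem bpcg_aux_rec (h hnew K : ℝ) (hh : 0 ≤ h) (hK : 0 ≤ K) (h1 : h * (K + 1) ≤ 2)
    (h2 : hnew ≤ h - h ^ 2 / 2) : hnew * (K + 1 + 1) ≤ 2 := by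
  have hle : h ≤ 2 := by nlinarith
  have h3 := mul_le_mul_of_nonneg_right h2 (by linarith : 0 ≤ K + 1 + 1)
  have h4 := mul_le_mul_of_nonneg_right h1 (by linarith : 0 ≤ 1 - h / 2)
  nlinarith [sq_nonneg h]

theorem bpcg_aux_main (V : Set H) (hn : ∀ v ∈ V, ‖v‖ = 1)
    (hp : ∀ u ∈ V, ∀ v ∈ V, 0 ≤ ⟪u, v⟫) (m : H) (hm : m ∈ closure (convexHull ℝ V))
    (run : BPCGRun (fun z => ‖z - m‖ ^ 2) (fun z => (2 : ℝ) • (z - m)) V) (t : ℕ) :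
    ∃ K : ℕ, ‖run.x t - m‖ ^ 2 * ((K : ℝ) + 1) ≤ 2 ∧ t + (run.S t).card ≤ 2 * K + 1 := by
  induction t with
  | zero =>
    refine ⟨0, ?_, ?_⟩
    · rw [norm_sub_rev]
      simpa using bpcg_aux_dist V hn hp m hm _ run.init_x
    · simp [run.init_S]
  | succ t ih =>
    obtain ⟨K, hK, hc⟩ := ih
    have hK0 : (0 : ℝ) ≤ K := Nat.cast_nonneg K
    set h := ‖run.x t - m‖ ^ 2 with hh
    have hh0 : 0 ≤ h := sq_nonneg _
    have hh2 : h ≤ 2 := by nlinarith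
    have hgap : 2 * h ≤ ⟪(2 : ℝ) • (run.x t - m), run.x t - run.w t⟫ := by
      have h1 := bpcg_aux_lin V _ _ (run.w_min t) m hm
      have h2 : ⟪(2 : ℝ) • (run.x t - m), run.x t - m⟫ = 2 * h := by
        rw [inner_smul_left, real_inner_self_eq_norm_sq]; simp [hh]
      rw [inner_sub_right] at h2 ⊢
      linarith
    by_cases hcase : ⟪(2 : ℝ) • (run.x t - m), run.x t - run.w t⟫ ≤
        ⟪(2 : ℝ) • (run.x t - m), run.a t - run.s t⟫
    · obtain ⟨hl, hmin, hx, hS1, hS2, -⟩ := run.step_pairwise t hcase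
      have hD : ‖run.a t - run.s t‖ ^ 2 ≤ 2 :=
        bpcg_aux_dist V hn hp _ (subset_closure (subset_convexHull ℝ V
          (run.S_subset t (run.a_mem t)))) _ (run.S_subset t (run.s_mem t))
      simp only [bpcg_aux_expand] at hmin
      rcases hl.2.lt_or_eq with hlt | heq
      · have htr := bpcg_aux_trial h _ _ hh0 (hgap.trans hcase) hD
        have hdec : ‖run.x (t + 1) - m‖ ^ 2 ≤ h - h ^ 2 / 2 := by
          rw [hx, bpcg_aux_expand]
          refine le_trans ?_ htr
          by_cases hL : h / 2 ≤ run.c t (run.a t)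
          · exact hmin _ ⟨by linarith, hL⟩
          · exact bpcg_aux_interior _ _ _ _ _ _ (sq_nonneg _) hlt (not_le.mp hL)
              (hmin _ ⟨hl.1.trans hl.2, le_refl _⟩)
        refine ⟨K + 1, ?_, ?_⟩
        · push_cast
          exact bpcg_aux_rec h _ K hh0 hK0 hK hdec
        · rw [hS1 hlt]; omega
      · refine ⟨K, ?_, ?_⟩
        · have hdec : ‖run.x (t + 1) - m‖ ^ 2 ≤ h := by
            rw [hx, bpcg_aux_expand]
            have := hmin 0 ⟨le_refl _, hl.1.trans hl.2⟩
            simpa using this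
          exact le_trans (mul_le_mul_of_nonneg_right hdec (by linarith)) hK
        · rw [hS2 heq, Finset.card_erase_of_mem (run.a_mem t)]
          have := Finset.card_pos.mpr ⟨_, run.a_mem t⟩
          omega
    · obtain ⟨hl, hmin, hx, hS, -⟩ := run.step_fw t (not_le.mp hcase)
      have hxV : run.x t ∈ convexHull ℝ V := by
        rw [run.x_eq t]
        exact (convex_convexHull ℝ V).sum_mem (fun v hv => (run.c_pos t v hv).le) (run.c_sum t)
          (fun v hv => subset_convexHull ℝ V (run.S_subset t hv))
      have hD : ‖run.x t - run.w t‖ ^ 2 ≤ 2 :=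
        bpcg_aux_dist V hn hp _ (subset_closure hxV) _ (run.w_mem t)
      simp only [bpcg_aux_expand] at hmin
      have htr := bpcg_aux_trial h _ _ hh0 hgap hD
      have hdec : ‖run.x (t + 1) - m‖ ^ 2 ≤ h - h ^ 2 / 2 := by
        rw [hx, bpcg_aux_expand]
        exact le_trans (hmin _ ⟨by linarith, by linarith⟩) htr
      refine ⟨K + 1, ?_, ?_⟩
      · push_cast
        exact bpcg_aux_rec h _ K hh0 hK0 hK hdec
      · have := Finset.card_insert_le (run.w t) (run.S t)
        rw [hS]; omega

/-- **Theorem 4.1 (BPCG kernel herding).**  Let `Ω` be a compact metric space, `H` a real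
Hilbert space, and `φ : Ω → H` a continuous feature map with `‖φ(x)‖ = 1` and
`⟪φ(x), φ(y)⟫ ≥ 0` (corresponding to a kernel `K(x,y) = ⟪φ(x), φ(y)⟫` with `K(x,x) = 1`
and `K(x,y) ≥ 0`).  Let `m` lie in the closed convex hull of `φ(Ω)` and
`f(z) = ‖z - m‖²` (whose gradient is `z ↦ 2(z - m)`).  Then every BPCG run on
`(f, φ(Ω))` satisfies `‖z_T - m‖² ≤ 16/T` for all `T ≥ 1`; when `m` is the mean embedding
of a probability measure `μ`, this says that the squared MMD of the quadrature produced by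
BPCG kernel herding is `O(1/T)`. -/
theorem bpcg_kernel_herding_mmd [CompleteSpace H]
    {Ω : Type*} [MetricSpace Ω] [CompactSpace Ω]
    (φ : Ω → H) (hφcont : Continuous φ)
    (hφnorm : ∀ x, ‖φ x‖ = 1)
    (hφnonneg : ∀ x y, 0 ≤ ⟪φ x, φ y⟫)
    (m : H) (hm : m ∈ closure (convexHull ℝ (Set.range φ)))
    (run : BPCGRun (fun z => ‖z - m‖ ^ 2) (fun z => (2 : ℝ) • (z - m)) (Set.range φ))
    (T : ℕ) (hT : 1 ≤ T) :
    ‖run.x T - m‖ ^ 2 ≤ 16 / (T : ℝ) := by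
  obtain ⟨K, hK, hc⟩ := bpcg_aux_main (Set.range φ) (by rintro _ ⟨x, rfl⟩; exact hφnorm x)
    (by rintro _ ⟨x, rfl⟩ _ ⟨y, rfl⟩; exact hφnonneg x y) m hm run T
  have hpos := Finset.card_pos.mpr ⟨_, run.a_mem T⟩
  have hTK : T ≤ 2 * K := by omega
  have hTKr : (T : ℝ) ≤ 2 * K := by exact_mod_cast hTK
  have hTr : (0 : ℝ) < T := by exact_mod_cast hT
  rw [le_div_iff₀ hTr]
  nlinarith [mul_le_mul_of_nonneg_left hTKr (sq_nonneg ‖run.x T - m‖),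
    sq_nonneg ‖run.x T - m‖]
end
end
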